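/- Let A ∈ M_n(ℤ) with det A ≠ 0, let f_A(x) = det(xI − A) be its characteristic polynomial, and write f_A(x) = (1 − x)^k g(x) where k ≥ 1 is the algebraic multiplicity of 1 as a root of f_A. Assume that no unimodular polynomial divides g in ℤ[x]. Let S be the set of μ ∈ 𝕋ⁿ such that the smallest closed subgroup of 𝕋ⁿ containing μ and the set {φ_A(x) − x : x ∈ 𝕋ⁿ} is all of 𝕋ⁿ. Then: S is a dense proper subset of 𝕋ⁿ; an affine map T(x) = λ + φ_A(x) is strongly transitive if and only if λ ∈ S; and no affine local homeomorphism of 𝕋ⁿ with linear part φ_A is exact. -/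

import Mathlib

/-- The `n`-torus `𝕋ⁿ = (ℝ/ℤ)ⁿ`, written additively. -/
abbrev Torus (n : ℕ) := Fin n → AddCircle (1 : ℝ)

/-- For an integer matrix `A ∈ Mₙ(ℤ)`, the group endomorphism `φ_A : 𝕋ⁿ → 𝕋ⁿ`
induced on the quotient by the linear map `x ↦ Ax` on `ℝⁿ`. -/
noncomputable def phiA {n : ℕ} (A : Matrix (Fin n) (Fin n) ℤ) (x : Torus n) : Torus n :=
  fun i => ∑ j, A i j • x j

/-- A nonconstant monic integer polynomial with constant term `±1` is unimodular. -/
def IsUnimodular (p : Polynomial ℤ) : Prop :=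
  p.Monic ∧ 0 < p.natDegree ∧ (p.coeff 0 = 1 ∨ p.coeff 0 = -1)

/-- A continuous map `ψ : X → X` is strongly transitive if for every nonempty open
subset `V ⊆ X` there is `N ∈ ℕ` such that `⋃_{i=0}^N ψ^i(V) = X`. -/
def StronglyTransitive {X : Type*} [TopologicalSpace X] (ψ : X → X) : Prop :=
  ∀ V : Set X, IsOpen V → V.Nonempty →
    ∃ N : ℕ, (⋃ i ∈ Finset.range (N + 1), ψ^[i] '' V) = Set.univ

/-- A continuous map `ψ : X → X` is exact if for every nonempty open subset
`V ⊆ X` there is `N ∈ ℕ` such that `ψ^N(V) = X`. -/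
def ExactMap {X : Type*} [TopologicalSpace X] (ψ : X → X) : Prop :=
  ∀ V : Set X, IsOpen V → V.Nonempty → ∃ N : ℕ, ψ^[N] '' V = Set.univ

/-- The set of `μ ∈ 𝕋ⁿ` such that the smallest closed subgroup of `𝕋ⁿ` containing
`μ` and the set `{φ_A(x) − x : x ∈ 𝕋ⁿ}` is all of `𝕋ⁿ`. -/
noncomputable def genSet {n : ℕ} (A : Matrix (Fin n) (Fin n) ℤ) : Set (Torus n) :=
  {μ | AddSubgroup.topologicalClosure
      (AddSubgroup.closure (insert μ {y : Torus n | ∃ x : Torus n, y = phiA A x - x})) = ⊤}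

open Polynomial in
theorem exists_mul_add_mul_eq_C {p g : ℤ[X]} (hp : p.Monic) (hp0 : IsUnit (p.coeff 0))
    (hdiv : ¬ ∃ q : ℤ[X], IsUnimodular q ∧ q ∣ g) :
    ∃ (a b : ℤ[X]) (c : ℤ), c ≠ 0 ∧ a * p + b * g = C c := by
  have hinj : Function.Injective (algebraMap ℤ ℚ) := (algebraMap ℤ ℚ).injective_int
  have hcop : IsCoprime (p.map (algebraMap ℤ ℚ)) (g.map (algebraMap ℤ ℚ)) := by
    rw [isCoprime_iff_aeval_ne_zero_of_isAlgClosed ℚ ℂ]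
    intro z
    by_contra! h
    obtain ⟨h1, h2⟩ := h
    rw [aeval_map_algebraMap] at h1 h2
    have hz : IsIntegral ℤ z := ⟨p, hp, h1⟩
    refine hdiv ⟨minpoly ℤ z, ⟨minpoly.monic hz, minpoly.natDegree_pos hz, ?_⟩,
      minpoly.isIntegrallyClosed_dvd hz h2⟩
    obtain ⟨q, hq⟩ := minpoly.isIntegrallyClosed_dvd hz h1
    rw [hq, mul_coeff_zero] at hp0
    exact Int.isUnit_iff.1 (isUnit_of_mul_isUnit_left hp0)
  obtain ⟨u, v, huv⟩ := hcop
  obtain ⟨b, hb, hbu⟩ := IsLocalization.integerNormalization_spec (nonZeroDivisors ℤ) u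
  obtain ⟨c, hc, hcv⟩ := IsLocalization.integerNormalization_spec (nonZeroDivisors ℤ) v
  refine ⟨C c * IsLocalization.integerNormalization (nonZeroDivisors ℤ) u,
    C b * IsLocalization.integerNormalization (nonZeroDivisors ℤ) v, b * c,
    mul_ne_zero (nonZeroDivisors.ne_zero hb) (nonZeroDivisors.ne_zero hc), ?_⟩
  apply map_injective _ hinj
  have e1 : ∀ (t : ℤ) (w : ℚ[X]), t • w = C (algebraMap ℤ ℚ t) * w := by
    intro t w
    simp [zsmul_eq_mul]
  simp only [Polynomial.map_add, Polynomial.map_mul, map_C, hbu, hcv, e1, map_mul]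
  linear_combination (C (algebraMap ℤ ℚ b) * C (algebraMap ℤ ℚ c)) * huv

open Polynomial in
theorem one_sub_pow_eq_zero_of_bijective {W : Type*} [AddCommGroup W] [Module.Free ℤ W]
    [Module.Finite ℤ W] (σ : Module.End ℤ W) (hσ : Function.Bijective σ) {k : ℕ} {g : ℤ[X]}
    (h0 : aeval σ ((1 - X) ^ k * g) = 0)
    (hdiv : ¬ ∃ q : ℤ[X], IsUnimodular q ∧ q ∣ g) : (1 - σ) ^ k = 0 := by
  have hdet : IsUnit (LinearMap.det σ) := by
    exact (LinearEquiv.ofBijective σ hσ).isUnit_det'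
  rw [LinearMap.det_eq_sign_charpoly_coeff] at hdet
  obtain ⟨a, b, c, hc, h⟩ := exists_mul_add_mul_eq_C (LinearMap.charpoly_monic σ)
    (isUnit_of_mul_isUnit_right hdet) hdiv
  have key : aeval σ ((1 - X) ^ k * C c : ℤ[X]) = 0 := by
    rw [← h, show ((1 - X) ^ k * (a * σ.charpoly + b * g) : ℤ[X])
      = (1 - X) ^ k * a * σ.charpoly + b * ((1 - X) ^ k * g) by ring, map_add, map_mul _ _ σ.charpoly,
      map_mul _ b, h0, LinearMap.aeval_self_charpoly]
    simp
  ext w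
  have := congrArg (fun f : Module.End ℤ W => f w) key
  simp only [map_mul, map_pow, map_sub, map_one, aeval_X, aeval_C, Module.End.mul_apply,
    Module.algebraMap_end_apply, map_smul, LinearMap.zero_apply] at this
  simpa [hc] using this

/-- The largest submodule on which an injective endomorphism acts bijectively. -/
def eventualRange {W : Type*} [AddCommGroup W] (τ : Module.End ℤ W) : Submodule ℤ W :=
  ⨅ i : ℕ, LinearMap.range (τ ^ i)

theorem mem_eventualRange {W : Type*} [AddCommGroup W] {τ : Module.End ℤ W} {w : W} :
    w ∈ eventualRange τ ↔ ∀ i : ℕ, ∃ v, (τ ^ i) v = w := by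
  simp [eventualRange]

theorem apply_mem_eventualRange {W : Type*} [AddCommGroup W] {τ : Module.End ℤ W} {w : W}
    (hw : w ∈ eventualRange τ) : τ w ∈ eventualRange τ := by
  rw [mem_eventualRange] at *
  intro i
  obtain ⟨v, rfl⟩ := hw i
  exact ⟨τ v, by rw [← Module.End.mul_apply, ← Module.End.mul_apply, (Commute.self_pow τ i).eq]⟩

theorem exists_mem_eventualRange_pow_apply_eq {W : Type*} [AddCommGroup W] {τ : Module.End ℤ W}
    (hτ : Function.Injective τ) {w : W} (hw : w ∈ eventualRange τ) (h : ℕ) :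
    ∃ v ∈ eventualRange τ, (τ ^ h) v = w := by
  rw [mem_eventualRange] at hw
  obtain ⟨v, rfl⟩ := hw h
  refine ⟨v, mem_eventualRange.2 fun i => ?_, rfl⟩
  obtain ⟨u, hu⟩ := hw (h + i)
  refine ⟨u, ?_⟩
  rw [pow_add, Module.End.mul_apply] at hu
  refine (show Function.Injective (τ ^ h) from ?_) hu
  rw [Module.End.coe_pow]
  exact hτ.iterate h

open Polynomial in
theorem one_sub_pow_apply_eq_zero {W : Type*} [AddCommGroup W] [Module.Free ℤ W]
    [Module.Finite ℤ W] {τ : Module.End ℤ W} (hτ : Function.Injective τ) {k : ℕ} {g : ℤ[X]}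
    (h0 : aeval τ ((1 - X) ^ k * g) = 0) (hdiv : ¬ ∃ q : ℤ[X], IsUnimodular q ∧ q ∣ g)
    {w : W} (hw : w ∈ eventualRange τ) : ((1 - τ) ^ k) w = 0 := by
  have hmaps : ∀ x ∈ eventualRange τ, τ x ∈ eventualRange τ := fun x => apply_mem_eventualRange
  let σ : Module.End ℤ (eventualRange τ) := τ.restrict hmaps
  have hbij : Function.Bijective σ := by
    constructor
    · intro x y hxy
      exact Subtype.ext (hτ (congrArg Subtype.val hxy))
    · intro x
      obtain ⟨v, hv, h⟩ := exists_mem_eventualRange_pow_apply_eq hτ x.2 1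
      exact ⟨⟨v, hv⟩, Subtype.ext (by rwa [pow_one] at h)⟩
  have hae : ∀ (q : ℤ[X]) (x : eventualRange τ), ((aeval σ q) x : W) = (aeval τ q) x := by
    intro q x
    induction q using Polynomial.induction_on' with
    | add p q hp hq => simp [hp, hq]
    | monomial n a =>
      simp only [aeval_monomial, Module.End.mul_apply, Module.algebraMap_end_apply]
      rw [Submodule.coe_smul, Module.End.pow_restrict]
      rfl
  have hσ0 : aeval σ ((1 - X) ^ k * g) = 0 := by
    ext x
    rw [hae, h0]
    rfl
  have := one_sub_pow_eq_zero_of_bijective σ hbij hσ0 hdiv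
  have h2 := hae ((1 - X) ^ k) ⟨w, hw⟩
  simp only [map_pow, map_sub, map_one, aeval_X] at h2
  rw [this] at h2
  exact h2.symm

theorem pow_apply_eq_self {W : Type*} [AddCommGroup W] [Module.IsTorsionFree ℤ W]
    {τ : Module.End ℤ W} {r h : ℕ} (hh : h ≠ 0) {w : W} (hr : ((1 - τ) ^ r) w = 0)
    (hw : (τ ^ h) w = w) : τ w = w := by
  induction r generalizing w with
  | zero => simp_all
  | succ r ih =>
    have hc : Commute (1 - τ) (τ ^ h) :=
      ((Commute.one_left τ).sub_left (Commute.refl τ)).pow_right h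
    have h1 : τ ((1 - τ) w) = (1 - τ) w := by
      refine ih ?_ ?_
      · rw [← Module.End.mul_apply, ← pow_succ, hr]
      · rw [← Module.End.mul_apply, ← hc.eq, Module.End.mul_apply, hw]
    have h2 : ∀ i : ℕ, (τ ^ i) w = w - (i : ℤ) • (1 - τ) w := by
      intro i
      induction i with
      | zero => simp
      | succ i ihi =>
        rw [pow_succ', Module.End.mul_apply, ihi, map_sub, map_smul, h1]
        simp only [LinearMap.sub_apply, Module.End.one_apply]
        push_cast
        module
    rw [h2] at hw
    have h3 : (h : ℤ) • (1 - τ) w = 0 := by simpa using hw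
    have h4 : (1 - τ) w = 0 := by
      rcases smul_eq_zero.1 h3 with h | h
      · exact absurd (by exact_mod_cast h) hh
      · exact h
    exact (sub_eq_zero.1 h4).symm

theorem one_sub_pow_apply_sub_eq_zero {W : Type*} [AddCommGroup W]
    {τ : Module.End ℤ W} (hτ : Function.Injective τ) {r h : ℕ} {v : W}
    (hr : ((1 - τ) ^ (r + 1)) ((τ ^ h) v) = 0) : ((1 - τ) ^ r) (v - (τ ^ h) v) = 0 := by
  have hinj : Function.Injective (τ ^ h) := by
    rw [Module.End.coe_pow]
    exact hτ.iterate h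
  have hc : Commute ((1 - τ) ^ (r + 1)) (τ ^ h) :=
    ((((Commute.one_left τ).sub_left (Commute.refl τ)).pow_right h).pow_left (r + 1))
  rw [← Module.End.mul_apply, hc.eq, Module.End.mul_apply] at hr
  have hv : ((1 - τ) ^ (r + 1)) v = 0 := hinj (by rw [hr, map_zero])
  have hg : (1 - τ ^ h) = (∑ i ∈ Finset.range h, τ ^ i) * (1 - τ) := by
    rw [geom_sum_mul_neg]
  have hc2 : Commute (1 - τ) (∑ i ∈ Finset.range h, τ ^ i) :=
    Commute.sum_right _ _ _ fun i _ => ((Commute.one_left τ).sub_left (Commute.refl τ)).pow_right i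
  have : v - (τ ^ h) v = (1 - τ ^ h) v := by simp
  rw [this, hg, ← Module.End.mul_apply, ← mul_assoc, (hc2.pow_left r).eq, mul_assoc, ← pow_succ,
    Module.End.mul_apply, hv, map_zero]

/-- The `N`-th Cesàro mean of a sequence of complex numbers. -/
noncomputable def cesaroMean (u : ℕ → ℂ) (N : ℕ) : ℂ :=
  (N : ℂ)⁻¹ * ∑ i ∈ Finset.range N, u i

open Filter Topology in
theorem tendsto_cesaroMean {u : ℕ → ℂ} {l : ℂ} (h : Tendsto u atTop (𝓝 l)) :
    Tendsto (cesaroMean u) atTop (𝓝 l) := by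
  refine h.cesaro_smul.congr fun N => ?_
  simp [cesaroMean]

theorem cesaroMean_sum {ι : Type*} (s : Finset ι) (f : ι → ℕ → ℂ) (N : ℕ) :
    cesaroMean (fun i => ∑ j ∈ s, f j i) N = ∑ j ∈ s, cesaroMean (f j) N := by
  simp only [cesaroMean]
  rw [Finset.sum_comm, Finset.mul_sum]

open Filter Topology in
theorem tendsto_inv_mul_of_norm_le {v : ℕ → ℂ} {B : ℝ} (hv : ∀ N, ‖v N‖ ≤ B) :
    Tendsto (fun N : ℕ => (N : ℂ)⁻¹ * v N) atTop (𝓝 0) := by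
  have h0 : Tendsto (fun N : ℕ => (N : ℝ)⁻¹ * B) atTop (𝓝 0) := by
    simpa using (tendsto_inv_atTop_nhds_zero_nat (𝕜 := ℝ)).mul_const B
  refine squeeze_zero_norm (fun N => ?_) h0
  rw [norm_mul, norm_inv, Complex.norm_natCast]
  exact mul_le_mul_of_nonneg_left (hv N) (by positivity)

open Filter Topology in
theorem tendsto_cesaroMean_shift_sub {u : ℕ → ℂ} (hu : ∀ i, ‖u i‖ ≤ 1) (h : ℕ) :
    Tendsto (fun N => cesaroMean (fun i => u (i + h)) N - cesaroMean u N) atTop (𝓝 0) := by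
  induction h with
  | zero => simp
  | succ h ih =>
    have h1 : Tendsto (fun N : ℕ => (N : ℂ)⁻¹ * (u (N + h) - u h)) atTop (𝓝 0) :=
      tendsto_inv_mul_of_norm_le (B := 2) fun N =>
        (norm_sub_le _ _).trans (by linarith [hu (N + h), hu h])
    have h2 := h1.add ih
    rw [add_zero] at h2
    refine h2.congr fun N => ?_
    have := Finset.sum_range_sub (fun i => u (i + h)) N
    rw [Finset.sum_sub_distrib] at this
    simp only [zero_add, add_right_comm _ 1 h] at this
    simp only [cesaroMean, ← add_assoc]
    rw [← this]
    ring

open Filter Topology in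
theorem tendsto_cesaroMean_shift {u : ℕ → ℂ} (hu : ∀ i, ‖u i‖ ≤ 1) (h : ℕ) {l : ℂ}
    (hl : Tendsto (cesaroMean u) atTop (𝓝 l)) :
    Tendsto (cesaroMean fun i => u (i + h)) atTop (𝓝 l) := by
  simpa using (tendsto_cesaroMean_shift_sub hu h).add hl

open ComplexConjugate in
theorem norm_cesaroMean_sq_le (w : ℕ → ℂ) (N : ℕ) :
    ‖cesaroMean w N‖ ^ 2 ≤ ‖cesaroMean (fun i => w i * conj (w i)) N‖ := by
  have h1 : ∑ i ∈ Finset.range N, w i * conj (w i)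
      = ((∑ i ∈ Finset.range N, ‖w i‖ ^ 2 : ℝ) : ℂ) := by
    push_cast
    exact Finset.sum_congr rfl fun i _ => Complex.mul_conj' _
  have h2 : ‖∑ i ∈ Finset.range N, w i‖ ^ 2 ≤ N * ∑ i ∈ Finset.range N, ‖w i‖ ^ 2 := by
    calc _ ≤ (∑ i ∈ Finset.range N, ‖w i‖) ^ 2 := by gcongr; exact norm_sum_le _ _
      _ ≤ _ := by simpa using sq_sum_le_card_mul_sum_sq (s := Finset.range N) (f := fun i => ‖w i‖)
  have h3 : 0 ≤ ∑ i ∈ Finset.range N, ‖w i‖ ^ 2 := by positivity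
  simp only [cesaroMean]
  rw [h1, norm_mul, norm_mul, norm_inv, Complex.norm_natCast, Complex.norm_real, Real.norm_eq_abs,
    abs_of_nonneg h3, mul_pow]
  rcases eq_or_ne N 0 with rfl | hN
  · simp
  · have hN' : (0 : ℝ) < N := by positivity
    calc ((N : ℝ)⁻¹) ^ 2 * ‖∑ i ∈ Finset.range N, w i‖ ^ 2
        ≤ ((N : ℝ)⁻¹) ^ 2 * (N * ∑ i ∈ Finset.range N, ‖w i‖ ^ 2) := by gcongr
      _ = _ := by field_simp

open Filter Topology ComplexConjugate in
/-- Van der Corput's criterion for unimodular sequences. -/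
theorem tendsto_cesaroMean_zero_of_correlations {u : ℕ → ℂ} (hu : ∀ i, ‖u i‖ = 1)
    (hcor : ∀ h, h ≠ 0 → Tendsto (cesaroMean fun i => u (i + h) * conj (u i)) atTop (𝓝 0)) :
    Tendsto (cesaroMean u) atTop (𝓝 0) := by
  have hcorr : ∀ h h' : ℕ, Tendsto (cesaroMean fun i => u (i + h) * conj (u (i + h'))) atTop
      (𝓝 (if h = h' then 1 else 0)) := by
    intro h h'
    have hb : ∀ a b : ℕ, ‖u a * conj (u b)‖ ≤ 1 := fun a b => by simp [hu]
    rcases lt_trichotomy h h' with hlt | rfl | hlt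
    · obtain ⟨d, rfl⟩ := Nat.exists_eq_add_of_lt hlt
      rw [if_neg (by omega)]
      have h1 := (hcor (d + 1) (by omega)).star
      rw [star_zero] at h1
      have h2 : Tendsto (cesaroMean fun i => u i * conj (u (i + (d + 1)))) atTop (𝓝 0) := by
        refine h1.congr fun N => ?_
        simp [cesaroMean, mul_comm]
      have h3 := tendsto_cesaroMean_shift (u := fun i => u i * conj (u (i + (d + 1))))
        (fun i => hb i _) h h2
      simpa only [add_assoc] using h3
    · rw [if_pos rfl]
      refine tendsto_cesaroMean (tendsto_const_nhds.congr fun i => ?_)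
      rw [Complex.mul_conj', hu]
      simp
    · obtain ⟨d, rfl⟩ := Nat.exists_eq_add_of_lt hlt
      rw [if_neg (by omega)]
      have h3 := tendsto_cesaroMean_shift (u := fun i => u (i + (d + 1)) * conj (u i))
        (fun i => hb _ i) h' (hcor (d + 1) (by omega))
      simpa only [add_assoc] using h3
  have hbound : ∀ H : ℕ, ∃ e : ℕ → ℝ, Tendsto e atTop (𝓝 (√H)) ∧
      ∀ N, H * ‖cesaroMean u N‖ ≤ e N := by
    intro H
    set w : ℕ → ℂ := fun i => ∑ h ∈ Finset.range H, u (i + h) with hw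
    have h1 : Tendsto (fun N => cesaroMean w N - H * cesaroMean u N) atTop (𝓝 0) := by
      have := tendsto_finsetSum (Finset.range H) fun h _ =>
        tendsto_cesaroMean_shift_sub (fun i => (hu i).le) h
      rw [Finset.sum_const_zero] at this
      refine this.congr fun N => ?_
      rw [hw, cesaroMean_sum, Finset.sum_sub_distrib]
      simp
    have h2 : Tendsto (cesaroMean fun i => w i * conj (w i)) atTop (𝓝 (H : ℂ)) := by
      have := tendsto_finsetSum (Finset.range H) fun h _ =>
        tendsto_finsetSum (Finset.range H) fun h' _ => hcorr h h'
      have hs : ∑ h ∈ Finset.range H, ∑ h' ∈ Finset.range H, (if h = h' then (1 : ℂ) else 0) = H := by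
        rw [Finset.sum_congr rfl (g := fun _ => (1 : ℂ))]
        · simp
        · intro h hh
          rw [Finset.sum_ite_eq, if_pos hh]
      rw [hs] at this
      refine this.congr fun N => ?_
      simp only [← cesaroMean_sum, hw, map_sum, Finset.sum_mul_sum]
    have h3 := (h2.norm).sqrt
    rw [Complex.norm_natCast] at h3
    refine ⟨_, by simpa using h1.norm.add h3, fun N => ?_⟩
    have h4 : ‖cesaroMean w N‖ ≤ √‖cesaroMean (fun i => w i * conj (w i)) N‖ :=
      Real.le_sqrt_of_sq_le (norm_cesaroMean_sq_le w N)
    calc (H : ℝ) * ‖cesaroMean u N‖ = ‖(H : ℂ) * cesaroMean u N‖ := by simp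
      _ ≤ ‖cesaroMean w N - H * cesaroMean u N‖ + ‖cesaroMean w N‖ := by
        rw [norm_sub_rev]
        exact norm_le_norm_sub_add _ _
      _ ≤ _ := by gcongr
  rw [tendsto_zero_iff_norm_tendsto_zero, Metric.tendsto_nhds]
  intro ε hε
  obtain ⟨H, hH⟩ := exists_nat_gt (1 / ε ^ 2)
  have hH0 : (0 : ℝ) < H := lt_trans (by positivity) hH
  obtain ⟨e, he, hle⟩ := hbound H
  have hlt : √H < ε * H := by
    rw [Real.sqrt_lt' (by positivity)]
    rw [div_lt_iff₀ (by positivity)] at hH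
    nlinarith
  filter_upwards [he.eventually_lt_const hlt] with N hN
  rw [dist_zero_right, norm_norm]
  have := (hle N).trans_lt hN
  rw [mul_comm] at this
  exact lt_of_mul_lt_mul_right this hH0.le

open MeasureTheory in
/-- Integration against normalized Haar measure, as a linear functional. -/
theorem exists_haar_functional (G : Type*) [AddCommGroup G] [TopologicalSpace G]
    [IsTopologicalAddGroup G] [CompactSpace G] [T2Space G] :
    ∃ I : C(G, ℂ) →ₗ[ℂ] ℂ, (∀ F, ‖I F‖ ≤ ‖F‖) ∧ I 1 = 1 ∧
      (∀ F : C(G, ℂ), (∀ x y, F (x + y) = F x * F y) → (∃ a, F a ≠ 1) → I F = 0) ∧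
      ∀ (F : C(G, ℂ)) (f : G → ℝ), (∀ x, F x = f x) → Continuous f → 0 ≤ f → (∃ x, f x ≠ 0) →
        I F ≠ 0 := by
  let _ : MeasurableSpace G := borel G
  have : BorelSpace G := ⟨rfl⟩
  let μ : Measure G := Measure.addHaarMeasure ⊤
  have hμ : μ Set.univ = 1 := by
    simpa using Measure.addHaarMeasure_self (K₀ := (⊤ : TopologicalSpace.PositiveCompacts G))
  have : IsProbabilityMeasure μ := ⟨hμ⟩
  have hint : ∀ F : C(G, ℂ), Integrable F μ := fun F =>
    F.continuous.integrable_of_hasCompactSupport (HasCompactSupport.of_compactSpace _)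
  refine ⟨{ toFun := fun F => ∫ x, F x ∂μ
            map_add' := fun F F' => integral_add (hint F) (hint F')
            map_smul' := fun c F => integral_smul c _ }, fun F => ?_, ?_, ?_, ?_⟩
  · refine (norm_integral_le_of_norm_le_const (C := ‖F‖)
      (Filter.Eventually.of_forall fun x => F.norm_coe_le_norm x)).trans ?_
    simp
  · simp
  · rintro F hF ⟨a, ha⟩
    have h1 : ∫ x, F (a + x) ∂μ = ∫ x, F x ∂μ := integral_add_left_eq_self _ a
    simp only [hF, integral_const_mul] at h1
    have h2 : (F a - 1) * ∫ x, F x ∂μ = 0 := by linear_combination h1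
    exact (mul_eq_zero.1 h2).resolve_left (sub_ne_zero.2 ha)
  · rintro F f hFf hf hf0 ⟨x, hx⟩
    have h1 : ∫ x, F x ∂μ = ((∫ x, f x ∂μ : ℝ) : ℂ) := by
      simp only [hFf]
      exact integral_ofReal
    change ∫ x, F x ∂μ ≠ 0
    rw [h1]
    exact_mod_cast (hf.integral_pos_of_hasCompactSupport_nonneg_nonzero
      (HasCompactSupport.of_compactSpace _) hf0 hx).ne'

open Filter Topology in
theorem tendsto_zero_of_span_dense {E : Type*} [NormedAddCommGroup E] [NormedSpace ℂ E]
    {s : Set E} (hs : (Submodule.span ℂ s).topologicalClosure = ⊤) {D : ℕ → E →ₗ[ℂ] ℂ} {B : ℝ}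
    (hD : ∀ N F, ‖D N F‖ ≤ B * ‖F‖) (h0 : ∀ F ∈ s, Tendsto (fun N => D N F) atTop (𝓝 0)) (F : E) :
    Tendsto (fun N => D N F) atTop (𝓝 0) := by
  have hspan : ∀ F ∈ Submodule.span ℂ s, Tendsto (fun N => D N F) atTop (𝓝 0) := by
    intro F hF
    induction hF using Submodule.span_induction with
    | mem x h => exact h0 x h
    | zero => simp
    | add x y _ _ hx hy => simpa using hx.add hy
    | smul a x _ hx => simpa using hx.const_mul a
  have hF : F ∈ closure (Submodule.span ℂ s : Set E) := by
    rw [← Submodule.topologicalClosure_coe, hs]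
    trivial
  rw [Metric.tendsto_nhds]
  intro ε hε
  have hB : 0 < |B| + 1 := by positivity
  obtain ⟨F', hF', hd⟩ := Metric.mem_closure_iff.1 hF (ε / 2 / (|B| + 1)) (by positivity)
  filter_upwards [Metric.tendsto_nhds.1 (hspan F' hF') (ε / 2) (by positivity)] with N hN
  rw [dist_zero_right] at hN ⊢
  rw [dist_eq_norm, lt_div_iff₀ hB] at hd
  have h1 : D N F = D N (F - F') + D N F' := by simp
  have h2 : B * ‖F - F'‖ ≤ ‖F - F'‖ * (|B| + 1) := by
    nlinarith [le_abs_self B, norm_nonneg (F - F')]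
  calc ‖D N F‖ ≤ ‖D N (F - F')‖ + ‖D N F'‖ := by rw [h1]; exact norm_add_le _ _
    _ < ε := by linarith [hD N (F - F')]

instance nontrivial_unitAddCircle : Nontrivial (AddCircle (1 : ℝ)) := by
  refine ⟨((1 / 2 : ℝ) : AddCircle (1 : ℝ)), 0, ?_⟩
  rw [Ne, AddCircle.coe_eq_zero_iff_of_mem_Ico (by norm_num)]
  norm_num

section Torus

variable {n : ℕ}

/-- The character `x ↦ ∑ mⱼ xⱼ` of the torus, with values in `ℝ/ℤ`. -/
noncomputable def torusChar (m : Fin n → ℤ) : Torus n →+ AddCircle (1 : ℝ) where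
  toFun x := ∑ j, m j • x j
  map_zero' := by simp
  map_add' x y := by simp [Finset.sum_add_distrib]

theorem continuous_torusChar (m : Fin n → ℤ) : Continuous (torusChar m) := by
  change Continuous fun x : Torus n => ∑ j, m j • x j
  fun_prop

theorem torusChar_sub (m m' : Fin n → ℤ) (x : Torus n) :
    torusChar (m - m') x = torusChar m x - torusChar m' x := by
  simp [torusChar, sub_smul]

theorem torusChar_phiA (A : Matrix (Fin n) (Fin n) ℤ) (m : Fin n → ℤ) (x : Torus n) :
    torusChar m (phiA A x) = torusChar (Matrix.vecMul m A) x := by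
  simp only [torusChar, phiA, AddMonoidHom.coe_mk, ZeroHom.coe_mk, Matrix.vecMul, dotProduct,
    Finset.smul_sum, Finset.sum_smul, mul_smul]
  exact Finset.sum_comm

theorem mFourier_eq_toCircle (m : Fin n → ℤ) (x : Torus n) :
    UnitAddTorus.mFourier m x = AddCircle.toCircle (torusChar m x) := by
  have h : ∀ s : Finset (Fin n), (AddCircle.toCircle (∑ j ∈ s, m j • x j) : ℂ)
      = ∏ j ∈ s, (AddCircle.toCircle (m j • x j) : ℂ) := by
    intro s
    induction s using Finset.cons_induction with
    | empty => simp
    | cons a s ha ih => rw [Finset.sum_cons, Finset.prod_cons, AddCircle.toCircle_add,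
        Circle.coe_mul, ih]
  simp only [UnitAddTorus.mFourier, ContinuousMap.coe_mk, fourier_apply]
  exact (h _).symm

theorem toCircle_eq_one_iff {t : AddCircle (1 : ℝ)} : (AddCircle.toCircle t : ℂ) = 1 ↔ t = 0 := by
  constructor
  · intro h
    apply AddCircle.injective_toCircle one_ne_zero
    ext
    simpa using h
  · rintro rfl
    simp

theorem zsmul_addCircle_surjective {d : ℤ} (hd : d ≠ 0) (t : AddCircle (1 : ℝ)) :
    ∃ s : AddCircle (1 : ℝ), d • s = t := by
  induction t using QuotientAddGroup.induction_on with
  | H r =>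
    refine ⟨((r / d : ℝ) : AddCircle (1 : ℝ)), ?_⟩
    rw [← AddCircle.coe_zsmul]
    congr 1
    have : (d : ℝ) ≠ 0 := by exact_mod_cast hd
    simp only [zsmul_eq_mul]
    field_simp

theorem torusChar_surjective {m : Fin n → ℤ} (hm : m ≠ 0) : Function.Surjective (torusChar m) := by
  intro t
  obtain ⟨j, hj⟩ := Function.ne_iff.1 hm
  obtain ⟨s, rfl⟩ := zsmul_addCircle_surjective hj t
  refine ⟨Pi.single j s, ?_⟩
  simp only [torusChar, AddMonoidHom.coe_mk, ZeroHom.coe_mk]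
  rw [Finset.sum_eq_single j]
  · simp
  · intro b _ hb
    simp [hb]
  · simp

theorem isOpenMap_torusChar {m : Fin n → ℤ} (hm : m ≠ 0) : IsOpenMap (torusChar m) :=
  (torusChar m).isOpenMap_of_sigmaCompact (torusChar_surjective hm) (continuous_torusChar m)

open Filter Topology in
/-- A closed set carrying functionals that become equidistributed is the whole torus. -/
theorem eq_univ_of_equidistributed {s : Set (Torus n)} (hs : IsClosed s)
    (L : ℕ → C(Torus n, ℂ) →ₗ[ℂ] ℂ) (hL : ∀ N F, ‖L N F‖ ≤ ‖F‖)
    (hsupp : ∀ N F, (∀ x ∈ s, F x = 0) → L N F = 0)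
    (h1 : Tendsto (fun N => L N 1) atTop (𝓝 1))
    (hm : ∀ m ≠ 0, Tendsto (fun N => L N (UnitAddTorus.mFourier m)) atTop (𝓝 0)) :
    s = Set.univ := by
  obtain ⟨I, hI, hI1, hIχ, hIpos⟩ := exists_haar_functional (Torus n)
  have hlim : ∀ F, Tendsto (fun N => (L N - I) F) atTop (𝓝 0) := by
    refine tendsto_zero_of_span_dense UnitAddTorus.span_mFourier_closure_eq_top (B := 2)
      (fun N F => ?_) ?_
    · exact (norm_sub_le _ _).trans (by linarith [hL N F, hI F])
    · rintro _ ⟨m, rfl⟩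
      simp only [LinearMap.sub_apply]
      rcases eq_or_ne m 0 with rfl | hm0
      · rw [UnitAddTorus.mFourier_zero, hI1]
        simpa using h1.sub_const 1
      · obtain ⟨t, ht⟩ := exists_ne (0 : AddCircle (1 : ℝ))
        obtain ⟨a, rfl⟩ := torusChar_surjective hm0 t
        rw [hIχ]
        · simpa using hm m hm0
        · intro x y
          simp [mFourier_eq_toCircle, AddCircle.toCircle_add]
        · refine ⟨a, ?_⟩
          rwa [mFourier_eq_toCircle, Ne, toCircle_eq_one_iff]
  have hne : s.Nonempty := by
    by_contra hemp
    rw [Set.not_nonempty_iff_eq_empty] at hemp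
    have h2 : ∀ N, L N 1 = 0 := fun N => hsupp N 1 (by simp [hemp])
    simp only [h2] at h1
    exact zero_ne_one (tendsto_nhds_unique tendsto_const_nhds h1)
  by_contra hs'
  obtain ⟨x, hx⟩ := (Set.ne_univ_iff_exists_notMem s).1 hs'
  let F : C(Torus n, ℂ) :=
    ⟨fun y => ((Metric.infDist y s : ℝ) : ℂ),
      Complex.continuous_ofReal.comp (Metric.continuous_infDist_pt s)⟩
  refine hIpos F (fun y => Metric.infDist y s) (fun _ => rfl) (Metric.continuous_infDist_pt s)
    (fun _ => Metric.infDist_nonneg) ⟨x, ((hs.notMem_iff_infDist_pos hne).1 hx).ne'⟩ ?_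
  have h2 : ∀ N, L N F = 0 := fun N => hsupp N F fun y hy => by
    simp [F, Metric.infDist_zero_of_mem hy]
  have h3 := hlim F
  simp only [LinearMap.sub_apply, h2, zero_sub] at h3
  simpa using tendsto_nhds_unique tendsto_const_nhds h3

open Filter Topology in
theorem exists_torusChar_eq_zero_of_ne_top {H : AddSubgroup (Torus n)}
    (hH : IsClosed (H : Set (Torus n))) (hne : H ≠ ⊤) :
    ∃ m : Fin n → ℤ, m ≠ 0 ∧ ∀ x ∈ H, torusChar m x = 0 := by
  by_contra! hcon
  apply hne
  have : CompactSpace H := isCompact_iff_compactSpace.1 hH.isCompact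
  obtain ⟨I, hI, hI1, hIχ, -⟩ := exists_haar_functional H
  let ι : C(H, Torus n) := ⟨Subtype.val, continuous_subtype_val⟩
  let J : C(Torus n, ℂ) →ₗ[ℂ] ℂ :=
    { toFun := fun F => I (F.comp ι)
      map_add' := fun F F' => by rw [ContinuousMap.add_comp, map_add]
      map_smul' := fun c F => by rw [ContinuousMap.smul_comp, map_smul]; rfl }
  rw [← AddSubgroup.coe_eq_univ]
  refine eq_univ_of_equidistributed hH (fun _ => J) (fun _ F => ?_) (fun _ F hF => ?_) ?_ ?_
  · refine (hI _).trans ((ContinuousMap.norm_le _ (norm_nonneg _)).2 fun x => ?_)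
    exact F.norm_coe_le_norm _
  · have : F.comp ι = 0 := by
      ext x
      exact hF _ x.2
    change I (F.comp ι) = 0
    rw [this, map_zero]
  · change Tendsto (fun _ => I 1) atTop (𝓝 1)
    rw [hI1]
    exact tendsto_const_nhds
  · intro m hm
    obtain ⟨a, ha, ha0⟩ := hcon m hm
    have : J (UnitAddTorus.mFourier m) = 0 := by
      refine hIχ _ (fun x y => ?_) ⟨⟨a, ha⟩, ?_⟩
      · simp [ι, mFourier_eq_toCircle, AddCircle.toCircle_add]
      · change UnitAddTorus.mFourier m a ≠ 1
        rwa [mFourier_eq_toCircle, Ne, toCircle_eq_one_iff]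
    simp only [this]
    exact tendsto_const_nhds

theorem mem_genSet_iff (A : Matrix (Fin n) (Fin n) ℤ) (μ : Torus n) :
    μ ∈ genSet A ↔ ∀ m : Fin n → ℤ, m ≠ 0 → Matrix.vecMul m A = m → torusChar m μ ≠ 0 := by
  constructor
  · intro hμ m hm hmA h0
    have hle : AddSubgroup.topologicalClosure (AddSubgroup.closure
        (insert μ {y : Torus n | ∃ x : Torus n, y = phiA A x - x})) ≤ (torusChar m).ker := by
      refine AddSubgroup.topologicalClosure_minimal _ ?_
        (isClosed_singleton.preimage (continuous_torusChar m))
      rw [AddSubgroup.closure_le]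
      rintro y (rfl | ⟨x, rfl⟩)
      · exact h0
      · change torusChar m (phiA A x - x) = 0
        rw [map_sub, torusChar_phiA, hmA, sub_self]
    obtain ⟨t, ht⟩ := exists_ne (0 : AddCircle (1 : ℝ))
    obtain ⟨a, rfl⟩ := torusChar_surjective hm t
    rw [show AddSubgroup.topologicalClosure _ = ⊤ from hμ] at hle
    exact ht (hle (AddSubgroup.mem_top a))
  · intro h
    by_contra hμ
    obtain ⟨m, hm, hmH⟩ := exists_torusChar_eq_zero_of_ne_top
      (AddSubgroup.isClosed_topologicalClosure _) hμ
    have hmem : ∀ y ∈ insert μ {y : Torus n | ∃ x : Torus n, y = phiA A x - x},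
        torusChar m y = 0 := fun y hy =>
      hmH y (AddSubgroup.le_topologicalClosure _ (AddSubgroup.subset_closure hy))
    refine h m hm ?_ (hmem μ (Set.mem_insert _ _))
    by_contra hmA
    obtain ⟨t, ht⟩ := exists_ne (0 : AddCircle (1 : ℝ))
    obtain ⟨x, rfl⟩ := torusChar_surjective (sub_ne_zero.2 hmA) t
    refine ht ?_
    rw [torusChar_sub, ← torusChar_phiA, ← map_sub]
    exact hmem _ (Or.inr ⟨x, rfl⟩)

theorem dense_genSet (A : Matrix (Fin n) (Fin n) ℤ) : Dense (genSet A) := by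
  have hd : Dense (⋂ m : {m : Fin n → ℤ // m ≠ 0}, torusChar m.1 ⁻¹' {0}ᶜ) := by
    refine dense_iInter_of_isOpen (fun m => ?_) fun m => ?_
    · exact isClosed_singleton.isOpen_compl.preimage (continuous_torusChar _)
    · exact (dense_compl_singleton 0).preimage (isOpenMap_torusChar m.2)
  refine hd.mono fun μ hμ => (mem_genSet_iff A μ).2 fun m hm _ => ?_
  exact Set.mem_iInter.1 hμ ⟨m, hm⟩

end Torus

section Dynamics

variable {n : ℕ}

theorem phiA_mul (A B : Matrix (Fin n) (Fin n) ℤ) (x : Torus n) :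
    phiA (A * B) x = phiA A (phiA B x) := by
  ext i
  simp only [phiA, Matrix.mul_apply, Finset.sum_smul, Finset.smul_sum, mul_smul]
  exact Finset.sum_comm

theorem phiA_smul_one (d : ℤ) (x : Torus n) : phiA (d • (1 : Matrix (Fin n) (Fin n) ℤ)) x = d • x := by
  ext i
  simp only [phiA, Matrix.smul_apply, Matrix.one_apply, smul_eq_mul, mul_ite, mul_one, mul_zero,
    ite_smul, zero_smul, Finset.sum_ite_eq, Finset.mem_univ, if_true, Pi.smul_apply]

/-- The endomorphism `phiA A` as a bundled homomorphism. -/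
noncomputable def phiHom (A : Matrix (Fin n) (Fin n) ℤ) : Torus n →+ Torus n where
  toFun := phiA A
  map_zero' := by ext i; simp [phiA]
  map_add' x y := by ext i; simp [phiA, Finset.sum_add_distrib]

theorem phiA_add (A : Matrix (Fin n) (Fin n) ℤ) (x y : Torus n) :
    phiA A (x + y) = phiA A x + phiA A y := (phiHom A).map_add x y

theorem continuous_phiA (A : Matrix (Fin n) (Fin n) ℤ) : Continuous (phiA A) := by
  unfold phiA
  fun_prop

theorem phiA_surjective {A : Matrix (Fin n) (Fin n) ℤ} (hA : A.det ≠ 0) :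
    Function.Surjective (phiA A) := by
  intro y
  choose s hs using fun i => zsmul_addCircle_surjective hA (y i)
  refine ⟨phiA A.adjugate s, ?_⟩
  rw [← phiA_mul, Matrix.mul_adjugate, phiA_smul_one]
  exact funext hs

theorem isOpenMap_phiA {A : Matrix (Fin n) (Fin n) ℤ} (hA : A.det ≠ 0) : IsOpenMap (phiA A) :=
  (phiHom A).isOpenMap_of_sigmaCompact (phiA_surjective hA) (continuous_phiA A)

theorem finite_ker_phiHom {A : Matrix (Fin n) (Fin n) ℤ} (hA : A.det ≠ 0) :
    Finite (phiHom A).ker := by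
  have hfin : {x : Torus n | ∀ i, x i ∈ {u : AddCircle (1 : ℝ) | A.det.natAbs • u = 0}}.Finite :=
    Set.Finite.pi' fun _ => AddCircle.finite_torsion (1 : ℝ) (Int.natAbs_pos.2 hA)
  refine (hfin.subset fun x hx i => ?_).to_subtype
  have h1 : phiA A.adjugate (phiA A x) = A.det • x := by
    rw [← phiA_mul, Matrix.adjugate_mul, phiA_smul_one]
  have h2 : A.det • x = 0 := by
    rw [← h1, show phiA A x = 0 from hx]
    exact (phiHom _).map_zero
  have h3 : A.det • x i = 0 := congrFun h2 i
  rcases Int.natAbs_eq A.det with h | h <;> rw [h] at h3 <;> simpa using h3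

theorem exists_vecMul_eq_of_torusChar_ker {B : Matrix (Fin n) (Fin n) ℤ} (hB : B.det ≠ 0)
    {m : Fin n → ℤ} (hm : ∀ x, phiA B x = 0 → torusChar m x = 0) :
    ∃ w, Matrix.vecMul w B = m := by
  have hd : (B.det : ℝ) ≠ 0 := by exact_mod_cast hB
  have hsum : ∀ (c : Fin n → ℤ) (j : Fin n),
      ∑ l, c l • (((B.adjugate l j : ℝ) / B.det : ℝ) : AddCircle (1 : ℝ))
        = (((Matrix.vecMul c B.adjugate j : ℤ) : ℝ) / B.det : ℝ) := by
    intro c j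
    simp only [← AddCircle.coe_zsmul]
    rw [← QuotientAddGroup.mk_sum]
    congr 1
    simp only [Matrix.vecMul, dotProduct, Int.cast_sum, Int.cast_mul, Finset.sum_div, zsmul_eq_mul,
      mul_div_assoc]
  have hw : ∀ j, ∃ w : ℤ, Matrix.vecMul m B.adjugate j = B.det * w := by
    intro j
    have h0 := hm (fun l => (((B.adjugate l j : ℝ) / B.det : ℝ) : AddCircle (1 : ℝ))) ?_
    · change ∑ l, m l • _ = 0 at h0
      rw [hsum, AddCircle.coe_eq_zero_iff] at h0
      obtain ⟨w, hw⟩ := h0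
      refine ⟨w, ?_⟩
      rw [eq_div_iff hd] at hw
      simp only [zsmul_eq_mul, mul_one] at hw
      rw [mul_comm]
      exact_mod_cast hw.symm
    · ext i
      change ∑ l, B i l • _ = 0
      rw [hsum (B i) j, show Matrix.vecMul (B i) B.adjugate j = (B * B.adjugate) i j from rfl,
        Matrix.mul_adjugate, AddCircle.coe_eq_zero_iff]
      refine ⟨(1 : Matrix (Fin n) (Fin n) ℤ) i j, ?_⟩
      simp only [Matrix.smul_apply, smul_eq_mul, Int.cast_mul, zsmul_eq_mul, mul_one]
      field_simp
  choose w hw using hw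
  refine ⟨w, ?_⟩
  have h1 : Matrix.vecMul m B.adjugate = B.det • w := funext hw
  have h2 := congrArg (fun v => Matrix.vecMul v B) h1
  simp only [Matrix.vecMul_vecMul, Matrix.adjugate_mul, Matrix.vecMul_smul, Matrix.vecMul_one,
    Matrix.smul_vecMul] at h2
  exact (smul_right_injective _ hB h2).symm

theorem toLin'_transpose_pow_apply (A : Matrix (Fin n) (Fin n) ℤ) (i : ℕ) (m : Fin n → ℤ) :
    (Matrix.toLin' A.transpose ^ i) m = Matrix.vecMul m (A ^ i) := by
  rw [← Matrix.toLin'_pow, Matrix.toLin'_apply, ← Matrix.transpose_pow, Matrix.mulVec_transpose]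

theorem toLin'_transpose_injective {A : Matrix (Fin n) (Fin n) ℤ} (hA : A.det ≠ 0) :
    Function.Injective (Matrix.toLin' A.transpose) := by
  rw [injective_iff_map_eq_zero]
  intro m hm
  exact Matrix.eq_zero_of_mulVec_eq_zero (by rwa [Matrix.det_transpose]) hm

theorem iterate_affine (A : Matrix (Fin n) (Fin n) ℤ) (lam x : Torus n) (h : ℕ) :
    (fun x => lam + phiA A x)^[h] x = (fun x => lam + phiA A x)^[h] 0 + phiA (A ^ h) x := by
  induction h with
  | zero =>
    have h1 := phiA_smul_one 1 x
    rw [one_smul, one_smul] at h1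
    simpa using h1.symm
  | succ h ih =>
    rw [Function.iterate_succ_apply', Function.iterate_succ_apply', ih, phiA_add, pow_succ',
      phiA_mul, add_assoc]

theorem iterate_backward_orbit {X : Type*} {T : X → X} {x : ℕ → X} (hx : ∀ i, T (x (i + 1)) = x i)
    (h i : ℕ) : T^[h] (x (i + h)) = x i := by
  induction h with
  | zero => rfl
  | succ h ih => rw [Function.iterate_succ_apply, ← add_assoc, hx, ih]

theorem norm_mFourier_apply (m : Fin n → ℤ) (x : Torus n) : ‖UnitAddTorus.mFourier m x‖ = 1 := by
  rw [mFourier_eq_toCircle, Circle.norm_coe]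

open Filter Topology in
theorem tendsto_cesaroMean_backward_orbit {A : Matrix (Fin n) (Fin n) ℤ} (hA : A.det ≠ 0)
    {lam : Torus n} (hlam : lam ∈ genSet A) {x : ℕ → Torus n}
    (hx : ∀ i, lam + phiA A (x (i + 1)) = x i) {r : ℕ} {m : Fin n → ℤ} (hm0 : m ≠ 0)
    (hm : m ∈ eventualRange (Matrix.toLin' A.transpose))
    (hr : ((1 - Matrix.toLin' A.transpose) ^ r) m = 0) :
    Tendsto (cesaroMean fun i => UnitAddTorus.mFourier m (x i)) atTop (𝓝 0) := by
  have hinj := toLin'_transpose_injective hA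
  induction r generalizing m with
  | zero => exact absurd hr hm0
  | succ r ih =>
    by_cases hfix : Matrix.vecMul m A = m
    · set c : ℂ := ((AddCircle.toCircle (-torusChar m lam) : Circle) : ℂ) with hc
      have hc1 : c - 1 ≠ 0 := by
        rw [sub_ne_zero, hc, Ne, toCircle_eq_one_iff, neg_eq_zero]
        exact (mem_genSet_iff A lam).1 hlam m hm0 hfix
      have hstep : ∀ i, UnitAddTorus.mFourier m (x (i + 1)) = c * UnitAddTorus.mFourier m (x i) := by
        intro i
        rw [← hx i, mFourier_eq_toCircle, mFourier_eq_toCircle, hc, map_add, torusChar_phiA, hfix,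
          ← Circle.coe_mul, ← AddCircle.toCircle_add, neg_add_cancel_left]
      have h1 := (tendsto_inv_mul_of_norm_le (B := 2)
        (v := fun N => UnitAddTorus.mFourier m (x N) - UnitAddTorus.mFourier m (x 0))
        fun N => (norm_sub_le _ _).trans (by simp only [norm_mFourier_apply]; norm_num)).const_mul
          (c - 1)⁻¹
      rw [mul_zero] at h1
      refine h1.congr fun N => ?_
      rw [← Finset.sum_range_sub (fun i => UnitAddTorus.mFourier m (x i)) N]
      simp only [hstep, ← sub_one_mul, ← Finset.mul_sum, cesaroMean]
      field_simp
    · refine tendsto_cesaroMean_zero_of_correlations (fun i => norm_mFourier_apply _ _) ?_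
      intro h hh
      obtain ⟨v, hv, rfl⟩ := exists_mem_eventualRange_pow_apply_eq hinj hm h
      have hw := ih (m := v - (Matrix.toLin' A.transpose ^ h) v) ?_ (sub_mem hv hm)
        (one_sub_pow_apply_sub_eq_zero hinj hr)
      · have h2 := hw.mul_const
          (AddCircle.toCircle (-torusChar v ((fun x => lam + phiA A x)^[h] 0)) : ℂ)
        rw [zero_mul] at h2
        refine h2.congr fun N => ?_
        simp only [cesaroMean]
        rw [mul_assoc, Finset.sum_mul]
        congr 1
        refine Finset.sum_congr rfl fun i _ => ?_
        have h3 := iterate_backward_orbit (T := fun x => lam + phiA A x) hx h i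
        rw [iterate_affine] at h3
        have h4 : torusChar ((Matrix.toLin' A.transpose ^ h) v) (x (i + h))
            = torusChar v (x i) - torusChar v ((fun x => lam + phiA A x)^[h] 0) := by
          rw [toLin'_transpose_pow_apply, ← torusChar_phiA, ← map_sub, ← h3, add_sub_cancel_left]
        rw [← UnitAddTorus.mFourier_neg]
        simp only [mFourier_eq_toCircle, ← Circle.coe_mul, ← AddCircle.toCircle_add, h4]
        rw [torusChar_sub, ← zero_sub ((Matrix.toLin' A.transpose ^ h) v), torusChar_sub]
        congr 2
        simp [torusChar]
        abel
      · intro h0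
        have h1 := (sub_eq_zero.1 h0).symm
        rw [h1] at hr hfix
        refine hfix ?_
        have h2 := pow_apply_eq_self hh hr h1
        rwa [Matrix.toLin'_apply, Matrix.mulVec_transpose] at h2

theorem norm_cesaroMean_le {u : ℕ → ℂ} {B : ℝ} (hB : 0 ≤ B) (hu : ∀ i, ‖u i‖ ≤ B) (N : ℕ) :
    ‖cesaroMean u N‖ ≤ B := by
  rw [cesaroMean, norm_mul, norm_inv, Complex.norm_natCast]
  have h1 : ‖∑ i ∈ Finset.range N, u i‖ ≤ N * B :=
    (norm_sum_le_of_le _ fun i _ => hu i).trans (by simp)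
  rcases eq_or_ne N 0 with rfl | hN
  · simpa using hB
  · rw [inv_mul_le_iff₀ (by positivity)]
    exact h1

/-- The mean of a continuous function over a translate of a finite subgroup. -/
noncomputable def cosetMean (K : AddSubgroup (Torus n)) [Fintype K] (x : Torus n) :
    C(Torus n, ℂ) →ₗ[ℂ] ℂ where
  toFun F := (Fintype.card K : ℂ)⁻¹ * ∑ κ : K, F (x + κ)
  map_add' F F' := by simp [Finset.sum_add_distrib, mul_add]
  map_smul' c F := by simp [← Finset.mul_sum, mul_left_comm]

theorem norm_cosetMean_le (K : AddSubgroup (Torus n)) [Fintype K] (x : Torus n)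
    (F : C(Torus n, ℂ)) : ‖cosetMean K x F‖ ≤ ‖F‖ := by
  change ‖(Fintype.card K : ℂ)⁻¹ * ∑ κ : K, F (x + κ)‖ ≤ ‖F‖
  rw [norm_mul, norm_inv, Complex.norm_natCast,
    inv_mul_le_iff₀ (by exact_mod_cast Fintype.card_pos)]
  exact (norm_sum_le_of_le _ fun κ _ => F.norm_coe_le_norm _).trans (by simp)

theorem cosetMean_eq_zero (K : AddSubgroup (Torus n)) [Fintype K] (x : Torus n) {m : Fin n → ℤ}
    {κ : Torus n} (hκ : κ ∈ K) (hm : torusChar m κ ≠ 0) :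
    cosetMean K x (UnitAddTorus.mFourier m) = 0 := by
  change (Fintype.card K : ℂ)⁻¹ * ∑ κ : K, UnitAddTorus.mFourier m (x + κ) = 0
  have h1 := Equiv.sum_comp (Equiv.addLeft (⟨κ, hκ⟩ : K))
    (fun κ : K => UnitAddTorus.mFourier m (x + κ))
  have h2 : ∀ κ' : K, UnitAddTorus.mFourier m (x + (Equiv.addLeft (⟨κ, hκ⟩ : K) κ' : K))
      = UnitAddTorus.mFourier m κ * UnitAddTorus.mFourier m (x + κ') := by
    intro κ'
    simp only [mFourier_eq_toCircle, ← Circle.coe_mul, ← AddCircle.toCircle_add, ← map_add,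
      Equiv.coe_addLeft, AddSubgroup.coe_add]
    rw [add_left_comm]
  simp only [h2, ← Finset.mul_sum] at h1
  have h3 : UnitAddTorus.mFourier m κ - 1 ≠ 0 := by
    rwa [sub_ne_zero, mFourier_eq_toCircle, Ne, toCircle_eq_one_iff]
  have h4 : (UnitAddTorus.mFourier m κ - 1) * ∑ κ : K, UnitAddTorus.mFourier m (x + κ) = 0 := by
    linear_combination h1
  rw [(mul_eq_zero.1 h4).resolve_left h3, mul_zero]

theorem cosetMean_eq_apply (K : AddSubgroup (Torus n)) [Fintype K] (x : Torus n) {m : Fin n → ℤ}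
    (hm : ∀ κ ∈ K, torusChar m κ = 0) :
    cosetMean K x (UnitAddTorus.mFourier m) = UnitAddTorus.mFourier m x := by
  change (Fintype.card K : ℂ)⁻¹ * ∑ κ : K, UnitAddTorus.mFourier m (x + κ) = _
  have h1 : ∀ κ : K, UnitAddTorus.mFourier m (x + κ) = UnitAddTorus.mFourier m x := fun κ => by
    rw [mFourier_eq_toCircle, mFourier_eq_toCircle, map_add, hm κ κ.2, add_zero]
  simp [h1]

open Filter Topology in
theorem dense_backward_orbit {A : Matrix (Fin n) (Fin n) ℤ} (hA : A.det ≠ 0) {r : ℕ}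
    (hr : ∀ m ∈ eventualRange (Matrix.toLin' A.transpose),
      ((1 - Matrix.toLin' A.transpose) ^ r) m = 0)
    {lam : Torus n} (hlam : lam ∈ genSet A) (y : Torus n) :
    Dense {z : Torus n | ∃ i : ℕ, (fun x => lam + phiA A x)^[i] z = y} := by
  rw [dense_iff_closure_eq]
  have hsurj : Function.Surjective fun x => lam + phiA A x := fun z => by
    obtain ⟨w, hw⟩ := phiA_surjective hA (z - lam)
    exact ⟨w, by simp [hw]⟩
  choose s hs using hsurj
  let x : ℕ → Torus n := fun i => s^[i] y
  have hx : ∀ i, lam + phiA A (x (i + 1)) = x i := fun i => by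
    simp only [x, Function.iterate_succ_apply']
    exact hs _
  have hAi : ∀ i : ℕ, (A ^ i).det ≠ 0 := fun i => by
    rw [Matrix.det_pow]
    exact pow_ne_zero i hA
  have hfin : ∀ i : ℕ, Finite (phiHom (A ^ i)).ker := fun i => finite_ker_phiHom (hAi i)
  let _ : ∀ i : ℕ, Fintype (phiHom (A ^ i)).ker := fun i => Fintype.ofFinite _
  let a : ℕ → C(Torus n, ℂ) →ₗ[ℂ] ℂ := fun i => cosetMean (phiHom (A ^ i)).ker (x i)
  let L : ℕ → C(Torus n, ℂ) →ₗ[ℂ] ℂ := fun N => (N : ℂ)⁻¹ • ∑ i ∈ Finset.range N, a i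
  have hLa : ∀ N F, L N F = cesaroMean (fun i => a i F) N := fun N F => by
    simp [L, cesaroMean]
  refine eq_univ_of_equidistributed isClosed_closure L (fun N F => ?_) (fun N F hF => ?_) ?_ ?_
  · rw [hLa]
    exact norm_cesaroMean_le (norm_nonneg _) (fun i => norm_cosetMean_le _ _ _) N
  · have h0 : ∀ i, a i F = 0 := by
      intro i
      change (Fintype.card _ : ℂ)⁻¹ * ∑ κ : (phiHom (A ^ i)).ker, F (x i + κ) = 0
      rw [Finset.sum_eq_zero, mul_zero]
      intro κ _
      refine hF _ (subset_closure ⟨i, ?_⟩)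
      have h1 := iterate_backward_orbit (T := fun x => lam + phiA A x) hx i 0
      rw [zero_add] at h1
      rw [iterate_affine, phiA_add, show phiA (A ^ i) κ = 0 from κ.2, add_zero, ← iterate_affine, h1]
      rfl
    rw [hLa]
    simp [h0, cesaroMean]
  · simp only [hLa]
    refine tendsto_cesaroMean (tendsto_const_nhds.congr fun i => ?_)
    rw [← UnitAddTorus.mFourier_zero]
    exact ((cosetMean_eq_apply _ _ fun κ _ => by simp [torusChar]).trans
      (by simp [UnitAddTorus.mFourier_zero])).symm
  · intro m hm0
    simp only [hLa]
    by_cases hm : m ∈ eventualRange (Matrix.toLin' A.transpose)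
    · refine (tendsto_cesaroMean_backward_orbit hA hlam hx hm0 hm (hr m hm)).congr fun N => ?_
      congr 1
      ext i
      refine (cosetMean_eq_apply _ _ fun κ hκ => ?_).symm
      obtain ⟨v, rfl⟩ := mem_eventualRange.1 hm i
      rw [toLin'_transpose_pow_apply, ← torusChar_phiA, show phiA (A ^ i) κ = 0 from hκ, map_zero]
    · rw [mem_eventualRange] at hm
      push Not at hm
      obtain ⟨i₀, hi₀⟩ := hm
      refine tendsto_cesaroMean (tendsto_const_nhds.congr' ?_)
      filter_upwards [eventually_ge_atTop i₀] with i hi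
      by_contra hne
      obtain ⟨w, hw⟩ := exists_vecMul_eq_of_torusChar_ker (hAi i) (m := m) fun κ hκ => by
        by_contra h
        exact hne (cosetMean_eq_zero _ _ (show κ ∈ (phiHom (A ^ i)).ker from hκ) h).symm
      obtain ⟨d, rfl⟩ := Nat.exists_eq_add_of_le hi
      refine hi₀ ((Matrix.toLin' A.transpose ^ d) w) ?_
      rw [← Module.End.mul_apply, ← pow_add, toLin'_transpose_pow_apply, hw]

theorem IsOpenMap.stronglyTransitive_of_dense_backward_orbit {X : Type*} [TopologicalSpace X]
    [CompactSpace X] {ψ : X → X} (hψ : IsOpenMap ψ)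
    (hd : ∀ y, Dense {z : X | ∃ i : ℕ, ψ^[i] z = y}) : StronglyTransitive ψ := by
  have hiter : ∀ i, IsOpenMap ψ^[i] := fun i => by
    induction i with
    | zero => exact IsOpenMap.id
    | succ i ih => exact ih.comp hψ
  intro V hV hne
  obtain ⟨t, ht⟩ := isCompact_univ.elim_finite_subcover (fun i : ℕ => ψ^[i] '' V)
    (fun i => hiter i V hV) fun y _ => by
      obtain ⟨z, hz, i, hi⟩ := (hd y).inter_open_nonempty V hV hne
      exact Set.mem_iUnion.2 ⟨i, z, hz, hi⟩
  refine ⟨t.sup id, Set.eq_univ_of_univ_subset (ht.trans ?_)⟩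
  refine Set.biUnion_subset_biUnion_left fun i hi => ?_
  exact Finset.mem_range.2 (Nat.lt_succ_of_le (Finset.le_sup (f := id) hi))

theorem torusChar_iterate_affine {A : Matrix (Fin n) (Fin n) ℤ} {m : Fin n → ℤ}
    (hm : Matrix.vecMul m A = m) (lam x : Torus n) (i : ℕ) :
    torusChar m ((fun x => lam + phiA A x)^[i] x) = i • torusChar m lam + torusChar m x := by
  induction i with
  | zero => simp
  | succ i ih =>
    rw [Function.iterate_succ_apply', map_add, torusChar_phiA, hm, ih, succ_nsmul']
    abel

theorem not_stronglyTransitive_of_torusChar_eq_zero {A : Matrix (Fin n) (Fin n) ℤ}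
    {m : Fin n → ℤ} (hm0 : m ≠ 0) (hm : Matrix.vecMul m A = m) {lam : Torus n}
    (hlam : torusChar m lam = 0) : ¬ StronglyTransitive fun x : Torus n => lam + phiA A x := by
  intro hst
  obtain ⟨t, ht⟩ := exists_ne (0 : AddCircle (1 : ℝ))
  obtain ⟨a, rfl⟩ := torusChar_surjective hm0 t
  obtain ⟨N, hN⟩ := hst (torusChar m ⁻¹' {0}ᶜ)
    (isClosed_singleton.isOpen_compl.preimage (continuous_torusChar m)) ⟨a, ht⟩
  have h0 : (0 : Torus n) ∈ ⋃ i ∈ Finset.range (N + 1),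
      (fun x => lam + phiA A x)^[i] '' (torusChar m ⁻¹' {0}ᶜ) := hN ▸ Set.mem_univ _
  simp only [Set.mem_iUnion] at h0
  obtain ⟨i, _, x, hx, h⟩ := h0
  have h1 := torusChar_iterate_affine hm lam x i
  rw [h, hlam, map_zero, smul_zero, zero_add] at h1
  exact hx h1.symm

theorem not_exactMap_affine {A : Matrix (Fin n) (Fin n) ℤ} {m : Fin n → ℤ} (hm0 : m ≠ 0)
    (hm : Matrix.vecMul m A = m) (lam : Torus n) :
    ¬ ExactMap fun x : Torus n => lam + phiA A x := by
  intro hex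
  obtain ⟨t, ht⟩ := exists_ne (0 : AddCircle (1 : ℝ))
  obtain ⟨a, rfl⟩ := torusChar_surjective hm0 t
  obtain ⟨N, hN⟩ := hex (torusChar m ⁻¹' {0}ᶜ)
    (isClosed_singleton.isOpen_compl.preimage (continuous_torusChar m)) ⟨a, ht⟩
  obtain ⟨x, hx, h⟩ : (fun x => lam + phiA A x)^[N] 0 ∈ (fun x => lam + phiA A x)^[N] ''
      (torusChar m ⁻¹' {0}ᶜ) := hN ▸ Set.mem_univ _
  have h1 := torusChar_iterate_affine hm lam x N
  rw [h, torusChar_iterate_affine hm, map_zero, add_right_inj] at h1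
  exact hx h1.symm

end Dynamics

theorem stmt6 {n : ℕ} (A : Matrix (Fin n) (Fin n) ℤ) (hA : A.det ≠ 0)
    (k : ℕ) (hk : 1 ≤ k) (g : Polynomial ℤ)
    (hfA : A.charpoly = (1 - Polynomial.X) ^ k * g) (hg1 : g.eval 1 ≠ 0)
    (hdiv : ¬ ∃ q : Polynomial ℤ, IsUnimodular q ∧ q ∣ g) :
    Dense (genSet A) ∧ genSet A ≠ Set.univ ∧
      (∀ lam : Torus n,
        StronglyTransitive (fun x : Torus n => lam + phiA A x) ↔ lam ∈ genSet A) ∧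
      (∀ lam : Torus n,
        IsLocalHomeomorph (fun x : Torus n => lam + phiA A x) →
          ¬ ExactMap (fun x : Torus n => lam + phiA A x)) := by
  have hτ0 : Polynomial.aeval (Matrix.toLin' A.transpose) ((1 - Polynomial.X) ^ k * g) = 0 := by
    rw [← hfA, ← Matrix.charpoly_transpose, ← Matrix.charpoly_toLin']
    exact LinearMap.aeval_self_charpoly _
  have hr := fun m hm =>
    one_sub_pow_apply_eq_zero (toLin'_transpose_injective hA) hτ0 hdiv (w := m) hm
  obtain ⟨m, hm0, hm⟩ : ∃ m : Fin n → ℤ, m ≠ 0 ∧ Matrix.vecMul m A = m := by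
    have hdet : (1 - A).det = 0 := by
      have h1 := Matrix.eval_charpoly A 1
      rw [hfA] at h1
      simpa [zero_pow (Nat.one_le_iff_ne_zero.1 hk)] using h1.symm
    obtain ⟨m, hm0, hm⟩ := Matrix.exists_vecMul_eq_zero_iff.2 hdet
    refine ⟨m, hm0, ?_⟩
    rw [Matrix.vecMul_sub, Matrix.vecMul_one, sub_eq_zero] at hm
    exact hm.symm
  refine ⟨dense_genSet A, fun h => ?_, fun lam => ⟨fun hst => ?_, fun hlam => ?_⟩,
    fun lam _ => not_exactMap_affine hm0 hm lam⟩
  · exact (mem_genSet_iff A 0).1 (h ▸ Set.mem_univ _) m hm0 hm (map_zero _)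
  · exact (mem_genSet_iff A lam).2 fun m' hm0' hm' h0 =>
      not_stronglyTransitive_of_torusChar_eq_zero hm0' hm' h0 hst
  · exact ((isOpenMap_add_left lam).comp
      (isOpenMap_phiA hA)).stronglyTransitive_of_dense_backward_orbit
      (dense_backward_orbit hA hr hlam)
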